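/- arXiv:math/0402037 — 3 statements merged into one kernel-verified Lean document; each statement's English description precedes it below -/
import Mathlib

section
/- Let n be a positive integer and let φ, ψ be ℂ-algebra automorphisms of K = ℂ(x,y), both of order n in Aut_ℂ(K), such that φ is the fractional-linear automorphism associated to some invertible 3×3 complex matrix A and ψ is the fractional-linear automorphism associated to some invertible 3×3 complex matrix B. Then φ and ψ are conjugate in Aut_ℂ(K): there exists χ ∈ Aut_ℂ(K) with χ ∘ φ ∘ χ⁻¹ = ψ. (This is the statement that two linear automorphisms of ℙ² of the same finite order n are conjugate in the Cremona group.) -/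
noncomputable section
open MvPolynomial

/-- `K = ℂ(x,y)`, the field of rational functions in two variables over `ℂ`. -/
abbrev K : Type := FractionRing (MvPolynomial (Fin 2) ℂ)

/-- The generator `x` of `K = ℂ(x,y)`. -/
def Kx : K := algebraMap (MvPolynomial (Fin 2) ℂ) K (X 0)

/-- The generator `y` of `K = ℂ(x,y)`. -/
def Ky : K := algebraMap (MvPolynomial (Fin 2) ℂ) K (X 1)

/-- `φ` is the fractional-linear automorphism of `K = ℂ(x,y)` associated to the matrix
`A ∈ GL(3, ℂ)`. -/
def IsFractionalLinear (φ : K ≃ₐ[ℂ] K) (A : Matrix (Fin 3) (Fin 3) ℂ) : Prop :=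
  IsUnit A.det ∧
  φ Kx = (algebraMap ℂ K (A 0 0) * Kx + algebraMap ℂ K (A 0 1) * Ky + algebraMap ℂ K (A 0 2)) /
         (algebraMap ℂ K (A 2 0) * Kx + algebraMap ℂ K (A 2 1) * Ky + algebraMap ℂ K (A 2 2)) ∧
  φ Ky = (algebraMap ℂ K (A 1 0) * Kx + algebraMap ℂ K (A 1 1) * Ky + algebraMap ℂ K (A 1 2)) /
         (algebraMap ℂ K (A 2 0) * Kx + algebraMap ℂ K (A 2 1) * Ky + algebraMap ℂ K (A 2 2))

namespace LinConj

lemma mem_of_gens (S : IntermediateField ℂ K) (hx : Kx ∈ S) (hy : Ky ∈ S) : S = ⊤ := by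
  have hp : ∀ p : MvPolynomial (Fin 2) ℂ, algebraMap _ K p ∈ S := by
    intro p
    induction p using MvPolynomial.induction_on with
    | C a =>
      have : algebraMap (MvPolynomial (Fin 2) ℂ) K (C a) = algebraMap ℂ K a := by
        rw [IsScalarTower.algebraMap_apply ℂ (MvPolynomial (Fin 2) ℂ) K]; rfl
      rw [this]; exact S.algebraMap_mem a
    | add p q hp hq => rw [map_add]; exact S.add_mem hp hq
    | mul_X p i hp =>
      rw [map_mul]
      refine S.mul_mem hp ?_
      fin_cases i
      · exact hx
      · exact hy
  rw [eq_top_iff]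
  intro z _
  obtain ⟨a, b, -, rfl⟩ := IsFractionRing.div_surjective (A := MvPolynomial (Fin 2) ℂ) z
  exact S.div_mem (hp a) (hp b)

lemma autExt (φ ψ : K ≃ₐ[ℂ] K) (hx : φ Kx = ψ Kx) (hy : φ Ky = ψ Ky) : φ = ψ := by
  let S : IntermediateField ℂ K :=
    { carrier := {z | φ z = ψ z}
      mul_mem' := by intro a b ha hb; simp only [Set.mem_ofPred_eq] at *; simp [ha, hb]
      add_mem' := by intro a b ha hb; simp only [Set.mem_ofPred_eq] at *; simp [ha, hb]
      algebraMap_mem' := by intro a; simp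
      inv_mem' := by intro a ha; simp only [Set.mem_ofPred_eq] at *; simp [ha] }
  have h : S = ⊤ := mem_of_gens S hx hy
  ext z
  have : z ∈ S := by rw [h]; trivial
  exact this

lemma exists_aut (f g : K)
    (hx : Kx ∈ IntermediateField.adjoin ℂ (Set.range ![f, g]))
    (hy : Ky ∈ IntermediateField.adjoin ℂ (Set.range ![f, g])) :
    ∃ χ : K ≃ₐ[ℂ] K, χ Kx = f ∧ χ Ky = g := by
  have htop := mem_of_gens _ hx hy
  have halg : Algebra.IsAlgebraic (Algebra.adjoin ℂ (Set.range ![f, g])) K := by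
    constructor
    intro z
    have hz : z ∈ IntermediateField.adjoin ℂ (Set.range ![f, g]) := by rw [htop]; trivial
    obtain ⟨r, hr, s, hs, rfl⟩ := IntermediateField.mem_adjoin_iff_div.1 hz
    rw [div_eq_mul_inv]
    refine IsAlgebraic.mul ?_ (IsAlgebraic.inv ?_)
    · exact isAlgebraic_algebraMap (⟨r, hr⟩ : Algebra.adjoin ℂ (Set.range ![f, g]))
    · exact isAlgebraic_algebraMap (⟨s, hs⟩ : Algebra.adjoin ℂ (Set.range ![f, g]))
  have : Algebra.IsAlgebraic (MvPolynomial (Fin 2) ℂ) K :=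
    IsLocalization.isAlgebraic _ (nonZeroDivisors (MvPolynomial (Fin 2) ℂ))
  have hb : IsTranscendenceBasis ℂ (algebraMap (MvPolynomial (Fin 2) ℂ) K ∘ X) :=
    (IsTranscendenceBasis.mvPolynomial (Fin 2) ℂ).algebraMap_comp
  have htr := hb.cardinalMk_eq_trdeg
  have hfg : IsTranscendenceBasis ℂ ![f, g] :=
    Algebra.IsAlgebraic.isTranscendenceBasis_of_le_trdeg_of_finite ℂ ![f, g] htr.le
  let e := hfg.1.aevalEquivField
  let e2 : K ≃ₐ[ℂ] K := (e.trans (IntermediateField.equivOfEq htop)).trans IntermediateField.topEquiv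
  refine ⟨e2, ?_, ?_⟩
  · have := hfg.1.aevalEquivField_algebraMap_apply_coe (X 0)
    exact this.trans (by simp)
  · have := hfg.1.aevalEquivField_algebraMap_apply_coe (X 1)
    exact this.trans (by simp)

/-- `δ` is the diagonal automorphism `x ↦ a x`, `y ↦ b y`. -/
def IsDiag (δ : K ≃ₐ[ℂ] K) (a b : ℂ) : Prop :=
  δ Kx = algebraMap ℂ K a * Kx ∧ δ Ky = algebraMap ℂ K b * Ky

lemma isDiag_conj (χ δ : K ≃ₐ[ℂ] K) {f g : K} {a b : ℂ} (hf : χ Kx = f) (hg : χ Ky = g)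
    (h1 : δ f = algebraMap ℂ K a * f) (h2 : δ g = algebraMap ℂ K b * g) :
    IsDiag (χ⁻¹ * δ * χ) a b := by
  subst hf hg
  constructor
  · change χ.symm (δ (χ Kx)) = _
    rw [h1]; simp
  · change χ.symm (δ (χ Ky)) = _
    rw [h2]; simp

lemma IsDiag.pow {δ : K ≃ₐ[ℂ] K} {a b : ℂ} (h : IsDiag δ a b) (k : ℕ) :
    IsDiag (δ ^ k) (a ^ k) (b ^ k) := by
  induction k with
  | zero => simp [IsDiag]
  | succ k ih =>
    constructor
    · rw [pow_succ, AlgEquiv.mul_apply, h.1, map_mul, ih.1]; simp [pow_succ]; ring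
    · rw [pow_succ, AlgEquiv.mul_apply, h.2, map_mul, ih.2]; simp [pow_succ]; ring

lemma Kx_ne : Kx ≠ 0 := by
  unfold Kx
  simp

lemma Ky_ne : Ky ≠ 0 := by
  unfold Ky
  simp

lemma IsDiag.eq_one_iff {δ : K ≃ₐ[ℂ] K} {a b : ℂ} (h : IsDiag δ a b) :
    δ = 1 ↔ a = 1 ∧ b = 1 := by
  constructor
  · rintro rfl
    obtain ⟨h1, h2⟩ := h
    simp only [AlgEquiv.one_apply] at h1 h2
    constructor
    · have h3 : algebraMap ℂ K a = 1 := mul_right_cancel₀ Kx_ne (by rw [← h1, one_mul])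
      exact (algebraMap ℂ K).injective (by rw [h3, map_one])
    · have h3 : algebraMap ℂ K b = 1 := mul_right_cancel₀ Ky_ne (by rw [← h2, one_mul])
      exact (algebraMap ℂ K).injective (by rw [h3, map_one])
  · rintro ⟨rfl, rfl⟩
    apply autExt
    · simp [h.1]
    · simp [h.2]

lemma mon (δ : K ≃ₐ[ℂ] K) (ζ : ℂ) (hζ : ζ ≠ 0) (i j : ℕ) (h : IsDiag δ (ζ ^ i) (ζ ^ j)) :
    ∃ χ : K ≃ₐ[ℂ] K, IsDiag (χ⁻¹ * δ * χ) (ζ ^ (Nat.gcd i j)) 1 := by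
  rcases Nat.eq_zero_or_pos (Nat.gcd i j) with h0 | hpos
  · obtain ⟨rfl, rfl⟩ := Nat.gcd_eq_zero_iff.1 h0
    exact ⟨1, by simpa using h⟩
  obtain ⟨i1, j1, hi, hj⟩ : ∃ i1 j1 : ℤ, (i : ℤ) = Nat.gcd i j * i1 ∧ (j : ℤ) = Nat.gcd i j * j1 := by
    obtain ⟨a, ha⟩ := Nat.gcd_dvd_left i j
    obtain ⟨b, hb⟩ := Nat.gcd_dvd_right i j
    exact ⟨a, b, by exact_mod_cast ha, by exact_mod_cast hb⟩
  obtain ⟨u, v, huv⟩ : ∃ u v : ℤ, (Nat.gcd i j : ℤ) = i * u + j * v :=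
    ⟨_, _, Nat.gcd_eq_gcd_ab i j⟩
  have hdet : i1 * u + j1 * v = 1 := by
    have hne : (Nat.gcd i j : ℤ) ≠ 0 := by exact_mod_cast hpos.ne'
    apply mul_left_cancel₀ hne
    linear_combination -huv - u * hi - v * hj
  have hx0 := Kx_ne
  have hy0 := Ky_ne
  set f : K := Kx ^ u * Ky ^ v with hf
  set g : K := Kx ^ (-j1) * Ky ^ i1 with hg
  have hfm : f ∈ IntermediateField.adjoin ℂ (Set.range ![f, g]) :=
    IntermediateField.subset_adjoin _ _ ⟨0, rfl⟩
  have hgm : g ∈ IntermediateField.adjoin ℂ (Set.range ![f, g]) :=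
    IntermediateField.subset_adjoin _ _ ⟨1, rfl⟩
  have key : ∀ p q : ℤ, f ^ p * g ^ q = Kx ^ (u * p - j1 * q) * Ky ^ (v * p + i1 * q) := by
    intro p q
    rw [hf, hg, mul_zpow, mul_zpow, ← zpow_mul, ← zpow_mul, ← zpow_mul, ← zpow_mul,
      sub_eq_add_neg, zpow_add₀ hx0, zpow_add₀ hy0, neg_mul]
    ring
  obtain ⟨χ, h1, h2⟩ := exists_aut f g (by
      have : Kx = f ^ i1 * g ^ (-v) := by
        rw [key, show u * i1 - j1 * (-v) = 1 by linear_combination hdet,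
          show v * i1 + i1 * (-v) = 0 by ring]
        simp
      rw [this]
      exact mul_mem (zpow_mem hfm _) (zpow_mem hgm _)) (by
      have : Ky = f ^ j1 * g ^ u := by
        rw [key, show v * j1 + i1 * u = 1 by linear_combination hdet,
          show u * j1 - j1 * u = 0 by ring]
        simp
      rw [this]
      exact mul_mem (zpow_mem hfm _) (zpow_mem hgm _))
  have hmon : ∀ p q : ℤ, δ (Kx ^ p * Ky ^ q) =
      algebraMap ℂ K (ζ ^ (i * p + j * q : ℤ)) * (Kx ^ p * Ky ^ q) := by
    intro p q
    rw [map_mul, map_zpow₀, map_zpow₀, h.1, h.2, mul_zpow, mul_zpow, ← map_zpow₀, ← map_zpow₀,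
      zpow_add₀ hζ, zpow_mul, zpow_mul, map_mul, zpow_natCast, zpow_natCast]
    ring
  refine ⟨χ, isDiag_conj χ δ h1 h2 ?_ ?_⟩
  · rw [hf, hmon, ← huv, zpow_natCast]
  · rw [hg, hmon, show (i * (-j1) + j * i1 : ℤ) = 0 by rw [hi, hj]; ring, zpow_zero]

/-- conjugation preserves orders -/
lemma orderOf_conj' (χ δ : K ≃ₐ[ℂ] K) : orderOf (χ⁻¹ * δ * χ) = orderOf δ := by
  have : χ⁻¹ * δ * χ = MulAut.conj χ⁻¹ δ := by simp
  rw [this]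
  exact orderOf_injective (MulAut.conj χ⁻¹).toMonoidHom (MulAut.conj χ⁻¹).injective δ

lemma diag_normal (n : ℕ) (hn : 0 < n) (δ : K ≃ₐ[ℂ] K) (hord : orderOf δ = n) (a b : ℂ)
    (h : IsDiag δ a b) (ζ : ℂ) (hζ : IsPrimitiveRoot ζ n) :
    ∃ χ : K ≃ₐ[ℂ] K, IsDiag (χ⁻¹ * δ * χ) ζ 1 := by
  have : NeZero n := ⟨hn.ne'⟩
  have hab := (h.pow n).eq_one_iff.1 (by rw [← hord, pow_orderOf_eq_one])
  obtain ⟨i, -, rfl⟩ := hζ.eq_pow_of_pow_eq_one hab.1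
  obtain ⟨j, -, rfl⟩ := hζ.eq_pow_of_pow_eq_one hab.2
  obtain ⟨χ, hχ⟩ := mon δ ζ (hζ.ne_zero hn.ne') i j h
  set g := Nat.gcd i j
  have hord2 : orderOf (χ⁻¹ * δ * χ) = n := by rw [orderOf_conj', hord]
  have hprim : orderOf (ζ ^ g) = n := by
    rw [← hord2]
    apply orderOf_eq_orderOf_iff.2
    intro m
    rw [(hχ.pow m).eq_one_iff]
    simp
  have hcop : Nat.Coprime g n :=
    (hζ.pow_iff_coprime hn g).1 (hprim ▸ IsPrimitiveRoot.orderOf (ζ ^ g))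
  obtain ⟨χ', hχ'⟩ := mon (χ⁻¹ * δ * χ) ζ (hζ.ne_zero hn.ne') g n (by rw [hζ.pow_eq_one]; exact hχ)
  refine ⟨χ * χ', ?_⟩
  rw [hcop, pow_one] at hχ'
  convert hχ' using 1
  group

/-- The affine-linear form with coefficient vector `w`. -/
def lf (w : Fin 3 → ℂ) : K :=
  algebraMap ℂ K (w 0) * Kx + algebraMap ℂ K (w 1) * Ky + algebraMap ℂ K (w 2)

/-- The affine-linear polynomial with coefficient vector `w`. -/
def lp (w : Fin 3 → ℂ) : MvPolynomial (Fin 2) ℂ := C (w 0) * X 0 + C (w 1) * X 1 + C (w 2)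

lemma lf_eq (w : Fin 3 → ℂ) : lf w = algebraMap _ K (lp w) := by
  have hC : ∀ a : ℂ, algebraMap ℂ K a = algebraMap (MvPolynomial (Fin 2) ℂ) K (C a) := by
    intro a
    rw [IsScalarTower.algebraMap_apply ℂ (MvPolynomial (Fin 2) ℂ) K]; rfl
  simp only [lf, lp, hC, map_add, map_mul, Kx, Ky]

lemma algMap_inj : Function.Injective (algebraMap (MvPolynomial (Fin 2) ℂ) K) :=
  IsFractionRing.injective _ _

lemma eval_lp (w : Fin 3 → ℂ) (s t : ℂ) : eval ![s, t] (lp w) = w 0 * s + w 1 * t + w 2 := by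
  simp [lp]

lemma lf_eq_zero {w : Fin 3 → ℂ} (h : lf w = 0) : w = 0 := by
  rw [lf_eq] at h
  have h' : lp w = 0 := algMap_inj (by rw [h, map_zero])
  have e : ∀ s t : ℂ, w 0 * s + w 1 * t + w 2 = 0 := by
    intro s t
    rw [← eval_lp, h', map_zero]
  have e0 := e 0 0
  have e1 := e 1 0
  have e2 := e 0 1
  ext i
  fin_cases i
  · change w 0 = 0
    linear_combination e1 - e0
  · change w 1 = 0
    linear_combination e2 - e0
  · change w 2 = 0
    linear_combination e0

lemma row_ne {A : Matrix (Fin 3) (Fin 3) ℂ} (hA : IsUnit A.det) (i : Fin 3) : A i ≠ 0 := by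
  intro h
  rw [Matrix.det_eq_zero_of_row_eq_zero i (fun j => congrFun h j)] at hA
  exact not_isUnit_zero hA

lemma action {φ : K ≃ₐ[ℂ] K} {A : Matrix (Fin 3) (Fin 3) ℂ} (h : IsFractionalLinear φ A)
    (w : Fin 3 → ℂ) : φ (lf w) = lf (Matrix.vecMul w A) / lf (A 2) := by
  obtain ⟨hA, hx, hy⟩ := h
  change φ Kx = lf (A 0) / lf (A 2) at hx
  change φ Ky = lf (A 1) / lf (A 2) at hy
  have h2 : lf (A 2) ≠ 0 := fun h => row_ne hA 2 (lf_eq_zero h)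
  have hlin : lf (Matrix.vecMul w A) = algebraMap ℂ K (w 0) * lf (A 0) +
      algebraMap ℂ K (w 1) * lf (A 1) + algebraMap ℂ K (w 2) * lf (A 2) := by
    simp only [lf, Matrix.vecMul, dotProduct, Fin.sum_univ_three, map_add, map_mul]
    ring
  rw [hlin, lf, map_add, map_add, map_mul, map_mul, hx, hy, AlgEquiv.commutes, AlgEquiv.commutes,
    AlgEquiv.commutes]
  field_simp

lemma action_pow {φ : K ≃ₐ[ℂ] K} {A : Matrix (Fin 3) (Fin 3) ℂ} (h : IsFractionalLinear φ A)
    (k : ℕ) : ∀ w : Fin 3 → ℂ,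
    (φ ^ k) (lf w) = lf (Matrix.vecMul w (A ^ k)) / lf ((A ^ k) 2) := by
  induction k with
  | zero =>
    intro w
    have : lf ((1 : Matrix (Fin 3) (Fin 3) ℂ) 2) = 1 := by simp [lf]
    simp [this]
  | succ k ih =>
    intro w
    have hk : IsUnit (A ^ k).det := by rw [Matrix.det_pow]; exact h.1.pow k
    have h2 : lf ((A ^ k) 2) ≠ 0 := fun h => row_ne hk 2 (lf_eq_zero h)
    rw [pow_succ, AlgEquiv.mul_apply, action h, map_div₀, ih, ih, div_div_div_cancel_right₀ h2,
      Matrix.vecMul_vecMul, ← pow_succ']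
    congr 2
    rw [pow_succ']
    ext j
    simp [Matrix.mul_apply, Matrix.vecMul, dotProduct]

lemma scalar_of_order {φ : K ≃ₐ[ℂ] K} {A : Matrix (Fin 3) (Fin 3) ℂ}
    (h : IsFractionalLinear φ A) (n : ℕ) (hn : φ ^ n = 1) :
    ∃ c : ℂ, c ≠ 0 ∧ A ^ n = c • (1 : Matrix (Fin 3) (Fin 3) ℂ) := by
  have hk : IsUnit (A ^ n).det := by rw [Matrix.det_pow]; exact h.1.pow n
  have h2 : lf ((A ^ n) 2) ≠ 0 := fun h => row_ne hk 2 (lf_eq_zero h)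
  have key := action_pow h n
  rw [hn] at key
  generalize A ^ n = M at *
  have ev : ∀ (w : Fin 3 → ℂ) (s t : ℂ), (w 0 * s + w 1 * t + w 2) *
      (M 2 0 * s + M 2 1 * t + M 2 2) =
      (Matrix.vecMul w M 0 * s + Matrix.vecMul w M 1 * t + Matrix.vecMul w M 2) := by
    intro w s t
    have h3 := key w
    rw [AlgEquiv.one_apply, eq_div_iff h2, lf_eq, lf_eq, lf_eq, ← map_mul] at h3
    have h4 := congrArg (eval ![s, t]) (algMap_inj h3)
    rwa [map_mul, eval_lp, eval_lp, eval_lp] at h4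
  have ex := ev ![1, 0, 0]
  have ey := ev ![0, 1, 0]
  simp [Matrix.vecMul, dotProduct, Fin.sum_univ_three] at ex ey
  have x00 := ex 0 0
  have x10 := ex 1 0
  have x20 := ex (-1) 0
  have x01 := ex 0 1
  have x11 := ex 1 1
  have y00 := ey 0 0
  have y10 := ey 1 0
  have y01 := ey 0 1
  have y02 := ey 0 (-1)
  simp only [mul_zero, zero_mul, add_zero, zero_add, mul_one, one_mul] at *
  have m20 : M 2 0 = 0 := by linear_combination (x10 + x20) / 2 - x00
  have m02 : M 0 2 = 0 := by linear_combination -x00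
  have m01 : M 0 1 = 0 := by linear_combination -x01 + x00
  have m12 : M 1 2 = 0 := by linear_combination -y00
  have m10 : M 1 0 = 0 := by linear_combination -y10 + y00
  have m21 : M 2 1 = 0 := by linear_combination (y01 + y02) / 2 - y00
  have m00 : M 0 0 = M 2 2 := by linear_combination -x10 + x00 + m20
  have m11 : M 1 1 = M 2 2 := by linear_combination -y01 + y00 + m21
  refine ⟨M 2 2, ?_, ?_⟩
  · intro h0
    apply row_ne hk 2
    ext j
    fin_cases j
    · exact m20
    · exact m21
    · exact h0
  · ext i j
    fin_cases i <;> fin_cases j <;> simp [m20, m02, m01, m12, m10, m21, m00, m11]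

lemma eigen_basis (A : Matrix (Fin 3) (Fin 3) ℂ) (n : ℕ) (hn : 0 < n) (c : ℂ) (hc : c ≠ 0)
    (h : A ^ n = c • (1 : Matrix (Fin 3) (Fin 3) ℂ)) :
    ∃ (P : Matrix (Fin 3) (Fin 3) ℂ) (l : Fin 3 → ℂ), IsUnit P.det ∧
      ∀ i, Matrix.vecMul (P i) A = l i • P i := by
  let T : Module.End ℂ (Fin 3 → ℂ) := Matrix.toLin' A.transpose
  have hT : Polynomial.aeval T (Polynomial.X ^ n - Polynomial.C c) = 0 := by
    have h1 : T ^ n = c • (1 : Module.End ℂ (Fin 3 → ℂ)) := by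
      rw [← Matrix.toLin'_pow, ← Matrix.transpose_pow, h]
      simp
      rfl
    simp [h1, Algebra.algebraMap_eq_smul_one]
  have hss : T.IsSemisimple := Module.End.isSemisimple_of_squarefree_aeval_eq_zero
    (Polynomial.separable_X_pow_sub_C c (by exact_mod_cast hn.ne') hc).squarefree hT
  have htop := hss.iSup_eigenspace_eq_top
  rw [Submodule.iSup_eq_span] at htop
  let b := Module.Basis.ofSpan htop.ge
  let b' : Module.Basis (Fin 3) ℂ (Fin 3 → ℂ) := b.reindex
    (b.indexEquiv (Pi.basisFun ℂ (Fin 3)))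
  have hb : ∀ i, ∃ μ : ℂ, T (b' i) = μ • b' i := by
    intro i
    have : b' i ∈ ⋃ μ : ℂ, (T.eigenspace μ : Set (Fin 3 → ℂ)) := by
      apply Module.Basis.ofSpan_subset htop.ge
      simp only [b', Module.Basis.reindex_apply]
      exact ⟨_, rfl⟩
    obtain ⟨μ, hμ⟩ := Set.mem_iUnion.1 this
    exact ⟨μ, Module.End.mem_eigenspace_iff.1 hμ⟩
  choose l hl using hb
  refine ⟨Matrix.of fun i => b' i, l, ?_, ?_⟩
  · rw [← Matrix.isUnit_iff_isUnit_det, ← Matrix.linearIndependent_rows_iff_isUnit]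
    exact b'.linearIndependent
  · intro i
    have := hl i
    rw [Matrix.toLin'_apply, Matrix.mulVec_transpose] at this
    exact this

lemma lin_diag {φ : K ≃ₐ[ℂ] K} {A : Matrix (Fin 3) (Fin 3) ℂ}
    (h : IsFractionalLinear φ A) (n : ℕ) (hn : 0 < n) (hord : φ ^ n = 1) :
    ∃ (χ : K ≃ₐ[ℂ] K) (a b : ℂ), IsDiag (χ⁻¹ * φ * χ) a b := by
  obtain ⟨c, hc, hAc⟩ := scalar_of_order h n hord
  obtain ⟨P, l, hP, hl⟩ := eigen_basis A n hn c hc hAc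
  have hP2 : lf (P 2) ≠ 0 := fun h => row_ne hP 2 (lf_eq_zero h)
  have hA2 : lf (A 2) ≠ 0 := fun h' => row_ne h.1 2 (lf_eq_zero h')
  have hsm : ∀ (a : ℂ) (w : Fin 3 → ℂ), lf (a • w) = algebraMap ℂ K a * lf w := by
    intro a w
    simp only [lf, Pi.smul_apply, smul_eq_mul, map_mul]
    ring
  have hl2 : algebraMap ℂ K (l 2) ≠ 0 := by
    intro h0
    have := action h (P 2)
    rw [hl, hsm, h0, zero_mul, zero_div] at this
    exact hP2 (by simpa using this)
  have hact : ∀ i, φ (lf (P i) / lf (P 2)) =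
      algebraMap ℂ K (l i / l 2) * (lf (P i) / lf (P 2)) := by
    intro i
    rw [map_div₀, action h, action h, hl, hl, hsm, hsm, map_div₀]
    field_simp
  set f : K := lf (P 0) / lf (P 2) with hf
  set g : K := lf (P 1) / lf (P 2) with hg
  set S := IntermediateField.adjoin ℂ (Set.range ![f, g]) with hS
  have hfm : f ∈ S := IntermediateField.subset_adjoin _ _ ⟨0, rfl⟩
  have hgm : g ∈ S := IntermediateField.subset_adjoin _ _ ⟨1, rfl⟩
  have hall : ∀ w : Fin 3 → ℂ, lf w / lf (P 2) ∈ S := by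
    intro w
    set u := Matrix.vecMul w P⁻¹ with hu
    have hw : w = Matrix.vecMul u P := by
      rw [hu, Matrix.vecMul_vecMul, Matrix.nonsing_inv_mul _ hP, Matrix.vecMul_one]
    have : lf w / lf (P 2) = algebraMap ℂ K (u 0) * f + algebraMap ℂ K (u 1) * g +
        algebraMap ℂ K (u 2) := by
      have hlin : lf (Matrix.vecMul u P) = algebraMap ℂ K (u 0) * lf (P 0) +
          algebraMap ℂ K (u 1) * lf (P 1) + algebraMap ℂ K (u 2) * lf (P 2) := by
        simp only [lf, Matrix.vecMul, dotProduct, Fin.sum_univ_three, map_add, map_mul]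
        ring
      rw [hw, hlin, hf, hg]
      field_simp
    rw [this]
    exact add_mem (add_mem (mul_mem (S.algebraMap_mem _) hfm) (mul_mem (S.algebraMap_mem _) hgm))
      (S.algebraMap_mem _)
  have e0 : lf ![1, 0, 0] = Kx := by simp [lf]
  have e1 : lf ![0, 1, 0] = Ky := by simp [lf]
  have e2 : lf ![0, 0, 1] = 1 := by simp [lf]
  have h1 := hall ![0, 0, 1]
  rw [e2] at h1
  have hx := div_mem (hall ![1, 0, 0]) h1
  have hy := div_mem (hall ![0, 1, 0]) h1
  rw [e0, div_div_div_cancel_right₀ hP2, div_one] at hx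
  rw [e1, div_div_div_cancel_right₀ hP2, div_one] at hy
  obtain ⟨χ, hχ1, hχ2⟩ := exists_aut f g hx hy
  exact ⟨χ, l 0 / l 2, l 1 / l 2, isDiag_conj χ φ hχ1 hχ2 (hact 0) (hact 1)⟩

lemma lin_normal {φ : K ≃ₐ[ℂ] K} {A : Matrix (Fin 3) (Fin 3) ℂ}
    (h : IsFractionalLinear φ A) (n : ℕ) (hn : 0 < n) (hord : orderOf φ = n) (ζ : ℂ)
    (hζ : IsPrimitiveRoot ζ n) :
    ∃ χ : K ≃ₐ[ℂ] K, IsDiag (χ⁻¹ * φ * χ) ζ 1 := by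
  obtain ⟨χ, a, b, hd⟩ := lin_diag h n hn (by rw [← hord, pow_orderOf_eq_one])
  obtain ⟨χ', hd'⟩ := diag_normal n hn _ (by rw [orderOf_conj', hord]) a b hd ζ hζ
  refine ⟨χ * χ', ?_⟩
  convert hd' using 1
  group

end LinConj

/-- Two fractional-linear automorphisms of `K = ℂ(x,y)` of the same finite order `n` are
conjugate in `Aut_ℂ(K)`: two linear automorphisms of `ℙ²` of the same finite order are
conjugate in the Cremona group. (In the automorphism group of `K`, multiplication is
composition, so `χ * φ * χ⁻¹` is the automorphism `χ ∘ φ ∘ χ⁻¹`.) -/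
theorem linear_automorphisms_of_same_order_conjugate (n : ℕ) (hn : 0 < n)
    (φ ψ : K ≃ₐ[ℂ] K)
    (hφord : orderOf φ = n) (hψord : orderOf ψ = n)
    (hφ : ∃ A : Matrix (Fin 3) (Fin 3) ℂ, IsFractionalLinear φ A)
    (hψ : ∃ B : Matrix (Fin 3) (Fin 3) ℂ, IsFractionalLinear ψ B) :
    ∃ χ : K ≃ₐ[ℂ] K, χ * φ * χ⁻¹ = ψ := by
  obtain ⟨A, hA⟩ := hφ
  obtain ⟨B, hB⟩ := hψ
  have hζ := Complex.isPrimitiveRoot_exp n hn.ne'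
  obtain ⟨α, hα⟩ := LinConj.lin_normal hA n hn hφord _ hζ
  obtain ⟨β, hβ⟩ := LinConj.lin_normal hB n hn hψord _ hζ
  have heq : α⁻¹ * φ * α = β⁻¹ * ψ * β :=
    LinConj.autExt _ _ (hα.1.trans hβ.1.symm) (hα.2.trans hβ.2.symm)
  refine ⟨β * α⁻¹, ?_⟩
  calc β * α⁻¹ * φ * (β * α⁻¹)⁻¹ = β * (α⁻¹ * φ * α) * β⁻¹ := by group
    _ = ψ := by rw [heq]; group

end
end

section
/- Let φ₀ be a ℂ-algebra automorphism of K = ℂ(x,y) with φ₀(x) = 1 − y and φ₀(y) = (x − y)/x. Then φ₀ is conjugate in Aut_ℂ(K) to a fractional-linear automorphism: there exist ψ ∈ Aut_ℂ(K) and an invertible 3×3 complex matrix A such that ψ ∘ φ₀ ∘ ψ⁻¹ is the fractional-linear automorphism associated to A. (This expresses that the automorphism of order 5 of the degree 5 Del Pezzo surface is conjugate, via a birational map to ℙ², to a linear automorphism of ℙ².) -/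
noncomputable section
open MvPolynomial

lemma transcendenceBasis_gens :
    IsTranscendenceBasis ℂ (fun i : Fin 2 => algebraMap (MvPolynomial (Fin 2) ℂ) K (X i)) := by
  have : Algebra.IsAlgebraic (MvPolynomial (Fin 2) ℂ) K :=
    IsLocalization.isAlgebraic K (nonZeroDivisors (MvPolynomial (Fin 2) ℂ))
  exact (IsTranscendenceBasis.mvPolynomial (Fin 2) ℂ).algebraMap_comp (A := K)

/-- Two elements generating `K` define an automorphism of `K`. -/
lemma exists_aut (w : Fin 2 → K)
    (hx : Kx ∈ IntermediateField.adjoin ℂ (Set.range w))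
    (hy : Ky ∈ IntermediateField.adjoin ℂ (Set.range w)) :
    ∃ θ : K ≃ₐ[ℂ] K, θ Kx = w 0 ∧ θ Ky = w 1 := by
  have hb := transcendenceBasis_gens
  have key : ∀ z ∈ IntermediateField.adjoin ℂ (Set.range w),
      IsAlgebraic (Algebra.adjoin ℂ (Set.range w)) z := by
    intro z hz
    rw [IntermediateField.mem_adjoin_iff_div] at hz
    obtain ⟨r, hr, s, hs, rfl⟩ := hz
    have h1 : IsAlgebraic (Algebra.adjoin ℂ (Set.range w)) r :=
      isAlgebraic_algebraMap (⟨r, hr⟩ : Algebra.adjoin ℂ (Set.range w))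
    have h2 : IsAlgebraic (Algebra.adjoin ℂ (Set.range w)) s :=
      isAlgebraic_algebraMap (⟨s, hs⟩ : Algebra.adjoin ℂ (Set.range w))
    rw [div_eq_mul_inv]
    exact h1.mul h2.inv
  have halg : Algebra.IsAlgebraic (Algebra.adjoin ℂ (Set.range w)) K := by
    rw [hb.isAlgebraic_iff]
    intro i
    fin_cases i
    · exact key _ hx
    · exact key _ hy
  have hw : IsTranscendenceBasis ℂ w := by
    apply Algebra.IsAlgebraic.isTranscendenceBasis_of_le_trdeg_of_finite ℂ w
    exact hb.cardinalMk_eq_trdeg.le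
  have htop : IntermediateField.adjoin ℂ (Set.range w) = ⊤ := by
    rw [eq_top_iff]
    intro z _
    obtain ⟨p, q, -, rfl⟩ := IsFractionRing.div_surjective (A := MvPolynomial (Fin 2) ℂ) z
    have hp : ∀ p : MvPolynomial (Fin 2) ℂ,
        algebraMap _ K p ∈ IntermediateField.adjoin ℂ (Set.range w) := by
      intro p
      induction p using MvPolynomial.induction_on with
      | C c =>
        have : algebraMap (MvPolynomial (Fin 2) ℂ) K (C c) = algebraMap ℂ K c :=
          (IsScalarTower.algebraMap_apply ℂ (MvPolynomial (Fin 2) ℂ) K c).symm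
        rw [this]
        exact IntermediateField.algebraMap_mem _ c
      | add p q hp hq => rw [map_add]; exact add_mem hp hq
      | mul_X p i hp =>
        rw [map_mul]
        refine mul_mem hp ?_
        fin_cases i
        · exact hx
        · exact hy
    exact div_mem (hp p) (hp q)
  refine ⟨hw.1.aevalEquivField.trans
    ((IntermediateField.equivOfEq htop).trans IntermediateField.topEquiv), ?_, ?_⟩
  · have := hw.1.aevalEquivField_algebraMap_apply_coe (X 0)
    rw [aeval_X] at this
    exact this
  · have := hw.1.aevalEquivField_algebraMap_apply_coe (X 1)
    rw [aeval_X] at this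
    exact this

lemma algebraMap_ne_zero_of_eval (p : MvPolynomial (Fin 2) ℂ) (f : Fin 2 → ℂ)
    (h : MvPolynomial.eval f p ≠ 0) : algebraMap (MvPolynomial (Fin 2) ℂ) K p ≠ 0 := by
  intro h0
  rw [map_eq_zero_iff _ (IsFractionRing.injective (MvPolynomial (Fin 2) ℂ) K)] at h0
  exact h (by rw [h0, map_zero])

/-- Recovering `x - α`, `y - β` from the images `u`, `v`. -/
lemma recover {F : Type*} [Field F] (x y α : F) (hα : α ^ 2 = 1 - α)
    (h1 : x - α ≠ 0) (h2 : y - (1 - α) ≠ 0) (h3 : x - y ≠ 0)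
    (hC : x * y + α * x - (1 + α) * y ≠ 0)
    (hN : ((x - α) - (y - (1 - α))) ^ 2 - (2 * α - 1) * (x - α) * (y - (1 - α)) ≠ 0)
    (u v : F) (hu : u = (x * y + α * x - (1 + α) * y) / ((y - (1 - α)) * (x - y)))
    (hv : v = (x * y + α * x - (1 + α) * y) / ((x - α) * (x - y))) :
    x = α + (u - v - (2 * α - 1) * u * v) / (v * (u - v - 1)) ∧
    y = (1 - α) + (u - v - (2 * α - 1) * u * v) / (u * (u - v - 1)) := by
  have hu0 : u ≠ 0 := by rw [hu]; positivity
  have hv0 : v ≠ 0 := by rw [hv]; positivity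
  have hd : (u - v - 1) * ((x - α) * (y - (1 - α)) * (x - y)) =
      ((x - α) - (y - (1 - α))) ^ 2 - (2 * α - 1) * (x - α) * (y - (1 - α)) := by
    rw [hu, hv]; field_simp
    linear_combination (x - y + 1 - 2 * α) * hα
  have hd0 : u - v - 1 ≠ 0 := by
    intro h; rw [h, zero_mul] at hd; exact hN hd.symm
  have e1 : (x - α) * (v * (u - v - 1)) = u - v - (2 * α - 1) * u * v := by
    rw [hu, hv]; field_simp
    linear_combination ((-2 * α - 1) * x * y - x * y ^ 2 + x ^ 2 * y + α * x ^ 2 + (α + 1) * y ^ 2) * hα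
  have e2 : (y - (1 - α)) * (u * (u - v - 1)) = u - v - (2 * α - 1) * u * v := by
    rw [hu, hv]; field_simp
    linear_combination ((-2 * α - 1) * x * y - x * y ^ 2 + x ^ 2 * y + α * x ^ 2 + (α + 1) * y ^ 2) * hα
  constructor
  · rw [← e1]; field_simp; ring
  · rw [← e2]; field_simp; ring

lemma transform {F : Type*} [Field F] (x y α : F) (hα : α ^ 2 = 1 - α)
    (h0 : x ≠ 0) (hy0 : y ≠ 0)
    (h1 : x - α ≠ 0) (h2 : y - (1 - α) ≠ 0) (h3 : x - y ≠ 0)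
    (h4 : α * x - y ≠ 0) (h5 : 1 - x ≠ 0)
    (u v X Y : F) (hu : u = (x * y + α * x - (1 + α) * y) / ((y - (1 - α)) * (x - y)))
    (hv : v = (x * y + α * x - (1 + α) * y) / ((x - α) * (x - y)))
    (hX : X = 1 - y) (hY : Y = (x - y) / x) :
    (X * Y + α * X - (1 + α) * Y) / ((Y - (1 - α)) * (X - Y)) =
      (α * v + (1 + α)) / ((α - 1) * v + α) ∧
    (X * Y + α * X - (1 + α) * Y) / ((X - α) * (X - Y)) =
      (-u + v + 1) / ((α - 1) * v + α) := by
  have hd : (α - 1) * v + α = ((1 - α) - y) * (α * x - y) * (1 - x) /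
      ((x - α) * (y - (1 - α)) * (x - y)) := by
    rw [hv]; field_simp
    linear_combination 0 * hα
  have n1 : α * v + (1 + α) = x * (y - (1 + α) * x + α) * ((1 - α) - y) /
      ((x - α) * (y - (1 - α)) * (x - y)) := by
    rw [hv]; field_simp
    linear_combination 0 * hα
  have n2 : -u + v + 1 = (y - (1 + α) * x + α) * (α * x - y) /
      ((x - α) * (y - (1 - α)) * (x - y)) := by
    rw [hu, hv]; field_simp
    linear_combination (x ^ 2 - y) * hα
  have c : X * Y + α * X - (1 + α) * Y = y * (y - (1 + α) * x + α) / x := by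
    rw [hX, hY]; field_simp; ring
  have d1 : Y - (1 - α) = (α * x - y) / x := by rw [hY]; field_simp; ring
  have d2 : X - Y = y * (1 - x) / x := by rw [hX, hY]; field_simp; ring
  have d3 : X - α = (1 - α) - y := by rw [hX]; ring
  have h2' : (1 - α) - y ≠ 0 := by rw [← neg_sub]; exact neg_ne_zero.mpr h2
  rw [hd, n1, n2, c, d1, d2, d3]
  constructor
  · field_simp
  · field_simp

/-- The order-5 Cremona transformation `φ₀ : x ↦ 1 - y, y ↦ (x-y)/x` (the automorphism of
order 5 of the degree 5 Del Pezzo surface) is conjugate in `Aut_ℂ(K)` to a fractional-linear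
(i.e. linear) automorphism of `ℙ²`. (In the automorphism group of `K`, multiplication is
composition, so `ψ * φ₀ * ψ⁻¹` is the automorphism `ψ ∘ φ₀ ∘ ψ⁻¹`.) -/
theorem order_five_cremona_conjugate_to_linear
    (φ₀ : K ≃ₐ[ℂ] K) (hx : φ₀ Kx = 1 - Ky) (hy : φ₀ Ky = (Kx - Ky) / Kx) :
    ∃ (ψ : K ≃ₐ[ℂ] K) (A : Matrix (Fin 3) (Fin 3) ℂ),
      IsFractionalLinear (ψ * φ₀ * ψ⁻¹) A := by
  obtain ⟨a, ha⟩ : ∃ a : ℂ, a ^ 2 = 1 - a := by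
    obtain ⟨r, hr⟩ := IsAlgClosed.exists_pow_nat_eq (5 : ℂ) (n := 2) (by norm_num)
    exact ⟨(-1 + r) / 2, by linear_combination hr / 4⟩
  set α : K := algebraMap ℂ K a with hαdef
  have hα : α ^ 2 = 1 - α := by rw [hαdef, ← map_pow, ha, map_sub, map_one]
  have hC : algebraMap (MvPolynomial (Fin 2) ℂ) K (C a) = α :=
    (IsScalarTower.algebraMap_apply ℂ (MvPolynomial (Fin 2) ℂ) K a).symm
  have ha0 : a ≠ 0 := by rintro rfl; norm_num at ha
  have k0 : Kx ≠ 0 := by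
    simpa [Kx] using algebraMap_ne_zero_of_eval (X 0) ![1, 0] (by simp)
  have ky : Ky ≠ 0 := by
    simpa [Ky] using algebraMap_ne_zero_of_eval (X 1) ![0, 1] (by simp)
  have k1 : Kx - α ≠ 0 := by
    have := algebraMap_ne_zero_of_eval (X 0 - C a) ![a + 1, 0] (by simp)
    rwa [map_sub, hC] at this
  have k2 : Ky - (1 - α) ≠ 0 := by
    have := algebraMap_ne_zero_of_eval (X 1 - (1 - C a)) ![0, 2 - a] (by simp; norm_num)
    rwa [map_sub, map_sub, map_one, hC] at this
  have k3 : Kx - Ky ≠ 0 := by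
    have := algebraMap_ne_zero_of_eval (X 0 - X 1) ![1, 0] (by simp)
    rwa [map_sub] at this
  have k4 : α * Kx - Ky ≠ 0 := by
    have := algebraMap_ne_zero_of_eval (C a * X 0 - X 1) ![0, 1] (by simp)
    rwa [map_sub, map_mul, hC] at this
  have k5 : 1 - Kx ≠ 0 := by
    have := algebraMap_ne_zero_of_eval (1 - X 0) ![0, 1] (by simp)
    rwa [map_sub, map_one] at this
  have kC : Kx * Ky + α * Kx - (1 + α) * Ky ≠ 0 := by
    have := algebraMap_ne_zero_of_eval (X 0 * X 1 + C a * X 0 - (1 + C a) * X 1) ![1, 0]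
      (by simpa using ha0)
    simpa only [Kx, Ky, map_sub, map_add, map_mul, map_one, hC] using this
  have kN : ((Kx - α) - (Ky - (1 - α))) ^ 2 - (2 * α - 1) * (Kx - α) * (Ky - (1 - α)) ≠ 0 := by
    have := algebraMap_ne_zero_of_eval
      (((X 0 - C a) - (X 1 - (1 - C a))) ^ 2 - (2 * C a - 1) * (X 0 - C a) * (X 1 - (1 - C a)))
      ![a + 1, 1 - a] (by simp)
    simpa only [Kx, Ky, map_sub, map_add, map_mul, map_one, map_pow, map_ofNat, hC] using this
  obtain ⟨u, hu⟩ : ∃ u, u = (Kx * Ky + α * Kx - (1 + α) * Ky) / ((Ky - (1 - α)) * (Kx - Ky)) :=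
    ⟨_, rfl⟩
  obtain ⟨v, hv⟩ : ∃ v, v = (Kx * Ky + α * Kx - (1 + α) * Ky) / ((Kx - α) * (Kx - Ky)) :=
    ⟨_, rfl⟩
  obtain ⟨rx, ry⟩ := recover Kx Ky α hα k1 k2 k3 kC kN u v hu hv
  obtain ⟨tu, tv⟩ := transform Kx Ky α hα k0 ky k1 k2 k3 k4 k5 u v _ _ hu hv hx hy
  have mu : u ∈ IntermediateField.adjoin ℂ (Set.range ![u, v]) :=
    IntermediateField.subset_adjoin _ _ ⟨0, rfl⟩
  have mv : v ∈ IntermediateField.adjoin ℂ (Set.range ![u, v]) :=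
    IntermediateField.subset_adjoin _ _ ⟨1, rfl⟩
  have mα : α ∈ IntermediateField.adjoin ℂ (Set.range ![u, v]) :=
    IntermediateField.algebraMap_mem _ a
  have m1 : (1 : K) ∈ IntermediateField.adjoin ℂ (Set.range ![u, v]) := one_mem _
  have m2 : (2 * α - 1 : K) ∈ IntermediateField.adjoin ℂ (Set.range ![u, v]) := by
    rw [two_mul]; exact sub_mem (add_mem mα mα) m1
  have mn := sub_mem (sub_mem mu mv) (mul_mem (mul_mem m2 mu) mv)
  have md := sub_mem (sub_mem mu mv) m1
  obtain ⟨θ, θx, θy⟩ := exists_aut ![u, v]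
    (by rw [rx]; exact add_mem mα (div_mem mn (mul_mem mv md)))
    (by rw [ry]; exact add_mem (sub_mem m1 mα) (div_mem mn (mul_mem mu md)))
  replace θx : θ Kx = u := θx
  replace θy : θ Ky = v := θy
  have φα : φ₀ α = α := φ₀.commutes a
  have θα : θ α = α := θ.commutes a
  have φu : φ₀ u = (α * v + (1 + α)) / ((α - 1) * v + α) := by
    rw [← tu, hu]; simp only [map_sub, map_add, map_mul, map_one, map_div₀, φα]
  have φv : φ₀ v = (-u + v + 1) / ((α - 1) * v + α) := by
    rw [← tv, hv]; simp only [map_sub, map_add, map_mul, map_one, map_div₀, φα]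
  refine ⟨θ⁻¹, !![0, a, 1 + a; -1, 1, 1; 0, a - 1, a], ?_, ?_, ?_⟩
  · rw [Matrix.det_fin_three]
    simp only [Matrix.of_apply, Matrix.cons_val]
    rw [isUnit_iff_ne_zero]
    ring_nf
    norm_num
  · apply θ.injective
    have : θ ((θ⁻¹ * φ₀ * θ⁻¹⁻¹) Kx) = φ₀ (θ Kx) := by
      rw [inv_inv]; exact θ.apply_symm_apply _
    rw [this, θx, φu]
    simp [θx, θy, θα, ← hαdef]
  · apply θ.injective
    have : θ ((θ⁻¹ * φ₀ * θ⁻¹⁻¹) Ky) = φ₀ (θ Ky) := by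
      rw [inv_inv]; exact θ.apply_symm_apply _
    rw [this, θy, φv]
    simp [θx, θy, θα, ← hαdef]

end
end

section
/- Let ω = (1 + √5)/2 ∈ ℂ, and let φ₀ be a ℂ-algebra automorphism of K = ℂ(x,y) with φ₀(x) = 1 − y and φ₀(y) = (x − y)/x. Then there exists a ℂ-algebra automorphism ψ of K with ψ(x) = ((x − ωy)(y − 1)(1 − ωx)) / ((x − y)(ω²y − 1)(1 − ωx)) and ψ(y) = ((ω⁻¹x − y)(ω²y − 1)(1 − x)) / ((x − y)(ω²y − 1)(1 − ωx)), and any such ψ satisfies: (i) ψ ∘ ψ = id (ψ is an involution), and (ii) the composite ψ ∘ φ₀ ∘ ψ is the linear automorphism α determined by α(x) = (y − ω⁻²)/y and α(y) = (y − ω⁻¹x)/y, i.e. the fractional-linear automorphism associated to the matrix with rows (0, 1, −ω⁻²), (−ω⁻¹, 1, 0), (0, 1, 0). -/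
noncomputable section
open MvPolynomial

theorem K_ne_zero (p : MvPolynomial (Fin 2) ℂ) (a b : ℂ) (h : eval ![a, b] p ≠ 0) :
    algebraMap (MvPolynomial (Fin 2) ℂ) K p ≠ 0 := by
  intro h0
  have : p = 0 := (IsFractionRing.injective (MvPolynomial (Fin 2) ℂ) K) (by rw [h0, map_zero])
  exact h (by rw [this, map_zero])

theorem K_algHom_ext (f g : K →ₐ[ℂ] K) (hx : f Kx = g Kx) (hy : f Ky = g Ky) : f = g := by
  have key : ∀ p : MvPolynomial (Fin 2) ℂ,
      f (algebraMap _ K p) = g (algebraMap _ K p) := by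
    intro p
    have : f.comp (IsScalarTower.toAlgHom ℂ (MvPolynomial (Fin 2) ℂ) K) =
        g.comp (IsScalarTower.toAlgHom ℂ (MvPolynomial (Fin 2) ℂ) K) := by
      apply MvPolynomial.algHom_ext
      intro i
      fin_cases i
      · exact hx
      · exact hy
    exact DFunLike.congr_fun this p
  apply AlgHom.ext
  intro z
  obtain ⟨p, q, -, rfl⟩ := IsFractionRing.div_surjective (A := MvPolynomial (Fin 2) ℂ) z
  rw [map_div₀, map_div₀, key, key]

theorem K_algC (c : ℂ) : algebraMap ℂ K c = algebraMap (MvPolynomial (Fin 2) ℂ) K (C c) := by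
  rw [IsScalarTower.algebraMap_apply ℂ (MvPolynomial (Fin 2) ℂ) K]; rfl

/-- All the nonvanishing facts that are needed. -/
theorem K_nonvanishing (ω : ℂ) (h0 : ω ≠ 0) :
    Kx ≠ 0 ∧ Ky ≠ 0 ∧ 1 - Kx ≠ 0 ∧ Kx - Ky ≠ 0 ∧ (algebraMap ℂ K ω) ^ 2 * Ky - 1 ≠ 0 ∧
    1 - algebraMap ℂ K ω * Kx ≠ 0 ∧ Kx - algebraMap ℂ K ω * Ky ≠ 0 ∧
    Kx - (algebraMap ℂ K ω - 1) * Ky + algebraMap ℂ K ω - 2 ≠ 0 ∧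
    Kx * Ky + (algebraMap ℂ K ω - 1) * Kx - algebraMap ℂ K ω * Ky ≠ 0 := by
  refine ⟨?_, ?_, ?_, ?_, ?_, ?_, ?_, ?_, ?_⟩
  · exact K_ne_zero (X 0) 1 0 (by simp)
  · exact K_ne_zero (X 1) 0 1 (by simp)
  · have := K_ne_zero (1 - X 0) 0 0 (by simp)
    simpa [Kx, Ky, K_algC] using this
  · have := K_ne_zero (X 0 - X 1) 1 0 (by simp)
    simpa [Kx, Ky, K_algC] using this
  · have := K_ne_zero (C ω ^ 2 * X 1 - 1) 0 0 (by simp)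
    simpa [Kx, Ky, K_algC] using this
  · have := K_ne_zero (1 - C ω * X 0) 0 0 (by simp)
    simpa [Kx, Ky, K_algC] using this
  · have := K_ne_zero (X 0 - C ω * X 1) 1 0 (by simp)
    simpa [Kx, Ky, K_algC] using this
  · have := K_ne_zero (X 0 - (C ω - 1) * X 1 + C ω - C 2) 2 0 (by simpa using h0)
    have h2 : algebraMap (MvPolynomial (Fin 2) ℂ) K (C 2) = 2 := by
      rw [← K_algC]; exact map_ofNat _ 2
    simpa only [Kx, Ky, K_algC, map_sub, map_add, map_mul, map_one, h2] using this
  · have := K_ne_zero (X 0 * X 1 + (C ω - 1) * X 0 - C ω * X 1) 0 1 (by simpa using h0)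
    simpa only [Kx, Ky, K_algC, map_sub, map_add, map_mul, map_one] using this

section FieldIdentities

variable {F : Type*} [Field F]

/-- First coordinate of the cubic map. -/
def cubX (w x y : F) : F := ((x - w * y) * (y - 1)) / ((x - y) * (w ^ 2 * y - 1))

/-- Second coordinate of the cubic map. -/
def cubY (w x y : F) : F := (((w - 1) * x - y) * (1 - x)) / ((x - y) * (1 - w * x))

theorem cub_aux1 {P Q L a b c x : F} (hP : P ≠ 0) (hQ : Q ≠ 0) (hL : L ≠ 0) (ha : a ≠ 0)
    (hb : b ≠ 0) (hc : c ≠ 0) :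
    P * Q / (a * b * c) * (x * L / (a * c)) / (P * L / (a * b * c) * (Q / (a * c))) = x := by
  field_simp

theorem cub_aux2 {P Q L a b c y v w : F} (hP : P ≠ 0) (hQ : Q ≠ 0) (hL : L ≠ 0) (ha : a ≠ 0)
    (hb : b ≠ 0) (hc : c ≠ 0) (h : v * w = 1) :
    v * (P * Q / (a * b * c)) * (w * y * L / (a * b)) /
      (P * L / (a * b * c) * (Q / (a * b))) = y := by
  field_simp
  linear_combination y * h

theorem cub_aux3 {P Q x y u D v w : F} (hP : P ≠ 0) (hx : x ≠ 0) (hy : y ≠ 0) (hu : u ≠ 0)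
    (hD : D ≠ 0) (h : v * w = 1) :
    -Q / x * (-y / x) / (y * u / x * (w * P / x)) = v ^ 2 * Q / D / (v * P * u / D) := by
  have hv : v ≠ 0 := left_ne_zero_of_mul_eq_one h
  have hw : w ≠ 0 := right_ne_zero_of_mul_eq_one h
  field_simp
  linear_combination (-Q) * h

theorem cub_invol (w x y : F) (hw : w ^ 2 = w + 1)
    (h1 : x - y ≠ 0) (h2 : w ^ 2 * y - 1 ≠ 0) (h3 : 1 - w * x ≠ 0) (h4 : x - w * y ≠ 0)
    (h5 : x - (w - 1) * y + w - 2 ≠ 0) (h6 : x * y + (w - 1) * x - w * y ≠ 0) :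
    cubX w (cubX w x y) (cubY w x y) = x ∧ cubY w (cubX w x y) (cubY w x y) = y := by
  have eX : cubX w x y = ((x - w * y) * (y - 1)) / ((x - y) * (w ^ 2 * y - 1)) := rfl
  have eY : cubY w x y = (((w - 1) * x - y) * (1 - x)) / ((x - y) * (1 - w * x)) := rfl
  generalize cubX w x y = A at *
  generalize cubY w x y = B at *
  rw [eq_div_iff (mul_ne_zero h1 h2)] at eX
  rw [eq_div_iff (mul_ne_zero h1 h3)] at eY
  have a1 : A - B = (x - w * y) * (x - (w - 1) * y + w - 2) /
      ((x - y) * (w ^ 2 * y - 1) * (1 - w * x)) := by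
    rw [eq_div_iff (mul_ne_zero (mul_ne_zero h1 h2) h3)]
    linear_combination (1 - w * x) * eX - (w ^ 2 * y - 1) * eY + (w * x * y * (x - 1) + y - x * y) * hw
  have a2 : 1 - w * A = (x * y + (w - 1) * x - w * y) / ((x - y) * (w ^ 2 * y - 1)) := by
    rw [eq_div_iff (mul_ne_zero h1 h2)]
    linear_combination (-w) * eX + (x * y - y) * hw
  have a3 : w ^ 2 * B - 1 = (x * y + (w - 1) * x - w * y) / ((x - y) * (1 - w * x)) := by
    rw [eq_div_iff (mul_ne_zero h1 h3)]
    linear_combination w ^ 2 * eY + (w * (x - x ^ 2) + x * y - y) * hw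
  have a4 : A - w * B = (x - w * y) * (x * y + (w - 1) * x - w * y) /
      ((x - y) * (w ^ 2 * y - 1) * (1 - w * x)) := by
    rw [eq_div_iff (mul_ne_zero (mul_ne_zero h1 h2) h3)]
    linear_combination (1 - w * x) * eX - w * (w ^ 2 * y - 1) * eY + (w ^ 2 * (x ^ 2 * y - x * y) + w * (y ^ 2 - x * y ^ 2) + x - x ^ 2 + x ^ 2 * y - x * y) * hw
  have a5 : B - 1 = x * (x - (w - 1) * y + w - 2) / ((x - y) * (1 - w * x)) := by
    rw [eq_div_iff (mul_ne_zero h1 h3)]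
    linear_combination eY
  have a6 : 1 - A = w * y * (x - (w - 1) * y + w - 2) / ((x - y) * (w ^ 2 * y - 1)) := by
    rw [eq_div_iff (mul_ne_zero h1 h2)]
    linear_combination - eX + (x * y - y) * hw
  have a7 : (w - 1) * A - B = (w - 1) * (A - w * B) := by
    linear_combination B * hw
  have hw1 : (w - 1) * w = 1 := by linear_combination hw
  constructor
  · unfold cubX
    rw [a1, a3, a4, a5]
    exact cub_aux1 h4 h6 h5 h1 h2 h3
  · unfold cubY
    rw [a7, a1, a2, a4, a6]
    exact cub_aux2 h4 h6 h5 h1 h2 h3 hw1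

theorem cub_conj (w x y : F) (hw : w ^ 2 = w + 1) (hx : x ≠ 0) (hy : y ≠ 0) (hx1 : 1 - x ≠ 0)
    (h1 : x - y ≠ 0) (h2 : w ^ 2 * y - 1 ≠ 0) (h3 : 1 - w * x ≠ 0) (h4 : x - w * y ≠ 0) :
    cubX w (1 - y) ((x - y) / x) = (cubY w x y - (w - 1) ^ 2) / cubY w x y ∧
    cubY w (1 - y) ((x - y) / x) = (cubY w x y - (w - 1) * cubX w x y) / cubY w x y := by
  have hw1 : (w - 1) * w = 1 := by linear_combination hw
  have hwne : w ≠ 0 := by rintro rfl; simp at hw1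
  have hwne1 : w - 1 ≠ 0 := by intro h; rw [h] at hw1; simp at hw1
  have b1 : 1 - y - (x - y) / x = y * (1 - x) / x := by field_simp; ring
  have b2 : (x - y) / x - 1 = - y / x := by field_simp; ring
  have b3 : 1 - y - w * ((x - y) / x) = - (x * y + (w - 1) * x - w * y) / x := by
    field_simp; ring
  have b4 : w ^ 2 * ((x - y) / x) - 1 = w * (x - w * y) / x := by
    field_simp; linear_combination x * hw
  have b5 : (w - 1) * (1 - y) - (x - y) / x = (w - 1) * (- (x * y + (w - 1) * x - w * y)) / x := by
    field_simp; linear_combination (x - y) * hw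
  have b6 : 1 - w * (1 - y) = (w - 1) * (w ^ 2 * y - 1) := by
    linear_combination (-w * y) * hw
  have c1 : (w - 1) * x - y = (w - 1) * (x - w * y) := by linear_combination y * hw
  have c2 : cubY w x y - (w - 1) ^ 2 = (w - 1) ^ 2 * (x * y + (w - 1) * x - w * y) /
      ((x - y) * (1 - w * x)) := by
    unfold cubY
    rw [c1]
    field_simp
    linear_combination (-x - x * y + x ^ 2 + y) * hw
  have c3 : cubY w x y - (w - 1) * cubX w x y =
      - (w - 1) * (x - w * y) * (x * y + (w - 1) * x - w * y) /
      ((x - y) * (w ^ 2 * y - 1) * (1 - w * x)) := by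
    unfold cubY cubX
    rw [c1]
    field_simp
    linear_combination (-x * y + y) * hw
  have c4 : cubY w x y = (w - 1) * (x - w * y) * (1 - x) / ((x - y) * (1 - w * x)) := by
    unfold cubY; rw [c1]
  constructor
  · rw [c2, c4]
    unfold cubX
    rw [b1, b2, b3, b4]
    exact cub_aux3 h4 hx hy hx1 (mul_ne_zero h1 h3) hw1
  · rw [c3, c4]
    unfold cubY
    rw [b1, b5, b6, show 1 - (1 - y) = y by ring]
    field_simp

end FieldIdentities

theorem golden (ω : ℂ) (hω : ω = (1 + (Real.sqrt 5 : ℂ)) / 2) : ω ^ 2 = ω + 1 := by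
  have h5 : ((Real.sqrt 5 : ℝ) : ℂ) ^ 2 = 5 := by
    rw [← Complex.ofReal_pow, Real.sq_sqrt (by norm_num)]; norm_num
  rw [hω]
  linear_combination h5 / 4

theorem map_cubX (g : K →ₐ[ℂ] K) (ω : ℂ) (a b : K) :
    g (cubX (algebraMap ℂ K ω) a b) = cubX (algebraMap ℂ K ω) (g a) (g b) := by
  simp [cubX]

theorem map_cubY (g : K →ₐ[ℂ] K) (ω : ℂ) (a b : K) :
    g (cubY (algebraMap ℂ K ω) a b) = cubY (algebraMap ℂ K ω) (g a) (g b) := by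
  simp [cubY]

theorem cub_algIndep (ω : ℂ) (hg : ω ^ 2 = ω + 1) (h0 : ω ≠ 0) :
    AlgebraicIndependent ℂ
      ![cubX (algebraMap ℂ K ω) Kx Ky, cubY (algebraMap ℂ K ω) Kx Ky] := by
  obtain ⟨-, -, -, n1, n2, n3, n4, n5, n6⟩ := K_nonvanishing ω h0
  have hW : (algebraMap ℂ K ω) ^ 2 = algebraMap ℂ K ω + 1 := by
    rw [← map_pow, hg, map_add, map_one]
  obtain ⟨i1, i2⟩ := cub_invol _ _ _ hW n1 n2 n3 n4 n5 n6
  set W := algebraMap ℂ K ω with hWdef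
  set A := cubX W Kx Ky
  set B := cubY W Kx Ky
  set S := Algebra.adjoin ℂ (Set.range ![A, B]) with hS
  have alg_mem : ∀ z ∈ S, IsAlgebraic S z := fun z hz => isAlgebraic_algebraMap (⟨z, hz⟩ : S)
  have hA : IsAlgebraic S A := alg_mem A (Algebra.subset_adjoin ⟨0, rfl⟩)
  have hB : IsAlgebraic S B := alg_mem B (Algebra.subset_adjoin ⟨1, rfl⟩)
  have hc : ∀ c : ℂ, IsAlgebraic S (algebraMap ℂ K c) := fun c => alg_mem _ (S.algebraMap_mem c)
  have hWa : IsAlgebraic S W := hc ω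
  have h1 : IsAlgebraic S (1 : K) := alg_mem 1 S.one_mem
  have hKx : IsAlgebraic S Kx := by
    rw [← i1]
    unfold cubX
    rw [div_eq_mul_inv]
    exact ((hA.sub (hWa.mul hB)).mul (hB.sub h1)).mul
      ((hA.sub hB).mul (((hWa.pow 2).mul hB).sub h1)).inv
  have hKy : IsAlgebraic S Ky := by
    rw [← i2]
    unfold cubY
    rw [div_eq_mul_inv]
    exact ((((hWa.sub h1).mul hA).sub hB).mul (h1.sub hA)).mul
      ((hA.sub hB).mul (h1.sub (hWa.mul hA))).inv
  have hpoly : ∀ p : MvPolynomial (Fin 2) ℂ,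
      IsAlgebraic S (algebraMap (MvPolynomial (Fin 2) ℂ) K p) := by
    intro p
    induction p using MvPolynomial.induction_on with
    | C c => rw [← K_algC]; exact hc c
    | add p q hp hq => rw [map_add]; exact hp.add hq
    | mul_X p i hp =>
      rw [map_mul]
      refine hp.mul ?_
      fin_cases i
      · exact hKx
      · exact hKy
  have : Algebra.IsAlgebraic S K := ⟨by
    intro z
    obtain ⟨p, q, -, rfl⟩ := IsFractionRing.div_surjective (A := MvPolynomial (Fin 2) ℂ) z
    rw [div_eq_mul_inv]
    exact (hpoly p).mul (hpoly q).inv⟩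
  refine (Algebra.IsAlgebraic.isTranscendenceBasis_of_le_trdeg_of_finite ℂ ![A, B] ?_).1
  have hle := _root_.trdeg_le_of_injective
    (IsScalarTower.toAlgHom ℂ (MvPolynomial (Fin 2) ℂ) K)
    (IsFractionRing.injective (MvPolynomial (Fin 2) ℂ) K)
  rw [MvPolynomial.trdeg_of_isDomain] at hle
  simpa using hle

theorem cub_comp_self (ω : ℂ) (hg : ω ^ 2 = ω + 1) (h0 : ω ≠ 0) (g : K →ₐ[ℂ] K)
    (gx : g Kx = cubX (algebraMap ℂ K ω) Kx Ky) (gy : g Ky = cubY (algebraMap ℂ K ω) Kx Ky) :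
    g.comp g = AlgHom.id ℂ K := by
  obtain ⟨-, -, -, n1, n2, n3, n4, n5, n6⟩ := K_nonvanishing ω h0
  have hW : (algebraMap ℂ K ω) ^ 2 = algebraMap ℂ K ω + 1 := by
    rw [← map_pow, hg, map_add, map_one]
  obtain ⟨i1, i2⟩ := cub_invol _ _ _ hW n1 n2 n3 n4 n5 n6
  apply K_algHom_ext
  · rw [AlgHom.comp_apply, gx, map_cubX, gx, gy, i1]; rfl
  · rw [AlgHom.comp_apply, gy, map_cubY, gx, gy, i2]; rfl

theorem cub_exists (ω : ℂ) (hg : ω ^ 2 = ω + 1) (h0 : ω ≠ 0) :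
    ∃ g : K →ₐ[ℂ] K, g Kx = cubX (algebraMap ℂ K ω) Kx Ky ∧
      g Ky = cubY (algebraMap ℂ K ω) Kx Ky := by
  have hi := cub_algIndep ω hg h0
  have key : ∀ p, IsFractionRing.liftAlgHom (K := K) hi (algebraMap _ K p) = aeval _ p :=
    fun p => IsFractionRing.lift_algebraMap hi p
  refine ⟨IsFractionRing.liftAlgHom (K := K) hi, ?_, ?_⟩
  · exact (key (X 0)).trans (by simp)
  · exact (key (X 1)).trans (by simp)

/-- The cubic involution `ψ` (coming from the projective transformation
`(x:y:z) ↦ ((x−ωy)(y−z)(z−ωx) : (ω⁻¹x−y)(ω²y−z)(z−x) : (x−y)(ω²y−z)(z−ωx))` read in the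
chart `z = 1`, with `ω = (1+√5)/2`) exists, is an involution, and conjugates the order-5
Cremona transformation `φ₀ : x ↦ 1−y, y ↦ (x−y)/x` to the linear automorphism
`α : x ↦ (y−ω⁻²)/y, y ↦ (y−ω⁻¹x)/y` associated to the matrix with rows
`(0,1,−ω⁻²), (−ω⁻¹,1,0), (0,1,0)`. (In the automorphism group of `K`, multiplication is
composition, so `ψ * φ₀ * ψ` is the automorphism `ψ ∘ φ₀ ∘ ψ`.) -/
theorem cubic_involution_conjugates_order_five_to_linear
    (ω : ℂ) (hω : ω = (1 + (Real.sqrt 5 : ℂ)) / 2)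
    (φ₀ : K ≃ₐ[ℂ] K) (hx : φ₀ Kx = 1 - Ky) (hy : φ₀ Ky = (Kx - Ky) / Kx) :
    (∃ ψ : K ≃ₐ[ℂ] K,
      ψ Kx = ((Kx - algebraMap ℂ K ω * Ky) * (Ky - 1) * (1 - algebraMap ℂ K ω * Kx)) /
             ((Kx - Ky) * (algebraMap ℂ K (ω ^ 2) * Ky - 1) * (1 - algebraMap ℂ K ω * Kx)) ∧
      ψ Ky = ((algebraMap ℂ K ω⁻¹ * Kx - Ky) * (algebraMap ℂ K (ω ^ 2) * Ky - 1) * (1 - Kx)) /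
             ((Kx - Ky) * (algebraMap ℂ K (ω ^ 2) * Ky - 1) * (1 - algebraMap ℂ K ω * Kx))) ∧
    ∀ ψ : K ≃ₐ[ℂ] K,
      ψ Kx = ((Kx - algebraMap ℂ K ω * Ky) * (Ky - 1) * (1 - algebraMap ℂ K ω * Kx)) /
             ((Kx - Ky) * (algebraMap ℂ K (ω ^ 2) * Ky - 1) * (1 - algebraMap ℂ K ω * Kx)) →
      ψ Ky = ((algebraMap ℂ K ω⁻¹ * Kx - Ky) * (algebraMap ℂ K (ω ^ 2) * Ky - 1) * (1 - Kx)) /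
             ((Kx - Ky) * (algebraMap ℂ K (ω ^ 2) * Ky - 1) * (1 - algebraMap ℂ K ω * Kx)) →
      ψ * ψ = 1 ∧
      (ψ * φ₀ * ψ) Kx = (Ky - algebraMap ℂ K (ω⁻¹ ^ 2)) / Ky ∧
      (ψ * φ₀ * ψ) Ky = (Ky - algebraMap ℂ K ω⁻¹ * Kx) / Ky := by
  have hg := golden ω hω
  have h0 : ω ≠ 0 := by rintro rfl; simp at hg
  have hinv : ω⁻¹ = ω - 1 := by
    rw [inv_eq_iff_eq_inv, eq_comm, inv_eq_iff_eq_inv]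
    exact eq_inv_of_mul_eq_one_left (by linear_combination hg)
  have hW : (algebraMap ℂ K ω) ^ 2 = algebraMap ℂ K ω + 1 := by
    rw [← map_pow, hg, map_add, map_one]
  obtain ⟨n01, n02, n03, n1, n2, n3, n4, n5, n6⟩ := K_nonvanishing ω h0
  have e1 : ((Kx - algebraMap ℂ K ω * Ky) * (Ky - 1) * (1 - algebraMap ℂ K ω * Kx)) /
      ((Kx - Ky) * (algebraMap ℂ K (ω ^ 2) * Ky - 1) * (1 - algebraMap ℂ K ω * Kx)) =
      cubX (algebraMap ℂ K ω) Kx Ky := by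
    rw [map_pow, mul_div_mul_right _ _ n3]; rfl
  have e2 : ((algebraMap ℂ K ω⁻¹ * Kx - Ky) * (algebraMap ℂ K (ω ^ 2) * Ky - 1) * (1 - Kx)) /
      ((Kx - Ky) * (algebraMap ℂ K (ω ^ 2) * Ky - 1) * (1 - algebraMap ℂ K ω * Kx)) =
      cubY (algebraMap ℂ K ω) Kx Ky := by
    rw [map_pow, hinv, map_sub, map_one, mul_right_comm, mul_right_comm (Kx - Ky),
      mul_div_mul_right _ _ n2]; rfl
  rw [e1, e2]
  constructor
  · obtain ⟨g, gx, gy⟩ := cub_exists ω hg h0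
    have gg := cub_comp_self ω hg h0 g gx gy
    exact ⟨AlgEquiv.ofAlgHom g g gg gg, gx, gy⟩
  · intro ψ px py
    have pp := cub_comp_self ω hg h0 (ψ : K →ₐ[ℂ] K) px py
    have pp' : ∀ z, ψ (ψ z) = z := fun z => DFunLike.congr_fun pp z
    obtain ⟨c1, c2⟩ := cub_conj _ _ _ hW n01 n02 n03 n1 n2 n3 n4
    have fX : φ₀ (cubX (algebraMap ℂ K ω) Kx Ky) =
        cubX (algebraMap ℂ K ω) (φ₀ Kx) (φ₀ Ky) := map_cubX (φ₀ : K →ₐ[ℂ] K) ω Kx Ky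
    have fY : φ₀ (cubY (algebraMap ℂ K ω) Kx Ky) =
        cubY (algebraMap ℂ K ω) (φ₀ Kx) (φ₀ Ky) := map_cubY (φ₀ : K →ₐ[ℂ] K) ω Kx Ky
    have hWi : algebraMap ℂ K ω⁻¹ = algebraMap ℂ K ω - 1 := by rw [hinv, map_sub, map_one]
    refine ⟨AlgEquiv.ext pp', ?_, ?_⟩
    · rw [AlgEquiv.mul_apply, AlgEquiv.mul_apply, px, fX, hx, hy, c1, ← py, map_pow, hWi,
        map_div₀, map_sub, pp', map_pow, map_sub, AlgEquiv.commutes, map_one]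
    · rw [AlgEquiv.mul_apply, AlgEquiv.mul_apply, py, fY, hx, hy, c2, ← px, ← py, hWi,
        map_div₀, map_sub, map_mul, pp', pp', map_sub, AlgEquiv.commutes, map_one]

end
end
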